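/- (One-step Lyapunov decrease) Under the Finito setup with Lyapunov function T = T1 + T2 + T3 + T4, if α ≥ 2, β ≥ 2, 2/α − 1/α² − β + β/α ≤ 0, and the big data condition n ≥ βL/s holds, then the uniform average over the choice of updated index j satisfies (1/n)∑_{j=1}^n T^{(j)} − T ≤ −(1/(αn)) T. -/

import Mathlib

open RealInnerProductSpace Finset

/-- The derivative of a function along a line, in terms of the gradient. -/
lemma hasDerivAt_comp_lineMap_of_differentiable
    {E : Type*} [NormedAddCommGroup E] [InnerProductSpace ℝ E] [CompleteSpace E]
    {f : E → ℝ} (hf : Differentiable ℝ f) (x y : E) (t : ℝ) :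
    HasDerivAt (fun t : ℝ => f (AffineMap.lineMap x y t))
      ⟪gradient f (AffineMap.lineMap x y t), y - x⟫ t := by
  rw [inner_gradient_left]
  exact (hf _).hasFDerivAt.comp_hasDerivAt t AffineMap.hasDerivAt_lineMap

/-- A differentiable strongly convex function lies above its tangent paraboloids. -/
lemma StrongConvexOn.add_inner_gradient_add_sq_le
    {E : Type*} [NormedAddCommGroup E] [InnerProductSpace ℝ E] [CompleteSpace E]
    {f : E → ℝ} {s : ℝ} (hsc : StrongConvexOn Set.univ s f) (hf : Differentiable ℝ f)
    (x y : E) :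
    f x + ⟪gradient f x, y - x⟫ + s / 2 * ‖y - x‖ ^ 2 ≤ f y := by
  have hconv := (strongConvexOn_iff_convex.mp hsc).comp_affineMap (AffineMap.lineMap x y)
  have hderiv := (hasDerivAt_comp_lineMap_of_differentiable hf x y 0).sub
    ((AffineMap.hasDerivAt_lineMap (a := x) (b := y) (x := (0 : ℝ))).norm_sq.const_mul (s / 2))
  have h := hconv.le_slope_of_hasDerivAt (x := 0) (y := 1) trivial trivial one_pos hderiv
  simp only [AffineMap.lineMap_apply_zero, slope_def_field, Function.comp_apply,
    AffineMap.lineMap_apply_one, sub_zero, div_one] at h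
  have hy : ‖y‖ ^ 2 = ‖x‖ ^ 2 + 2 * ⟪x, y - x⟫ + ‖y - x‖ ^ 2 := by
    rw [← norm_add_sq_real, add_sub_cancel]
  rw [hy] at h
  linarith

/-- The descent lemma: a function with Lipschitz gradient lies below its tangent paraboloids. -/
lemma le_add_inner_gradient_add_sq_of_lipschitz
    {E : Type*} [NormedAddCommGroup E] [InnerProductSpace ℝ E] [CompleteSpace E]
    {f : E → ℝ} {L : ℝ} (hf : Differentiable ℝ f)
    (hlip : ∀ x y, ‖gradient f x - gradient f y‖ ≤ L * ‖x - y‖) (x y : E) :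
    f y ≤ f x + ⟪gradient f x, y - x⟫ + L / 2 * ‖y - x‖ ^ 2 := by
  have hf' := hasDerivAt_comp_lineMap_of_differentiable hf x y
  have hB (t : ℝ) : HasDerivAt
      (fun t : ℝ => f x + ⟪gradient f x, y - x⟫ * t + L / 2 * ‖y - x‖ ^ 2 * t ^ 2)
      (⟪gradient f x, y - x⟫ + L * ‖y - x‖ ^ 2 * t) t := by
    refine ((((hasDerivAt_id t).const_mul ⟪gradient f x, y - x⟫).const_add (f x)).add
      (((hasDerivAt_id t).pow 2).const_mul (L / 2 * ‖y - x‖ ^ 2))).congr_deriv ?_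
    simp
    ring
  have h := image_le_of_deriv_right_le_deriv_boundary (a := 0) (b := 1)
    (fun t _ => (hf' t).continuousAt.continuousWithinAt)
    (fun t _ => (hf' t).hasDerivWithinAt) (by simp)
    (fun t _ => (hB t).continuousAt.continuousWithinAt)
    (fun t _ => (hB t).hasDerivWithinAt) ?_ (Set.right_mem_Icc.mpr zero_le_one)
  · simpa using h
  · intro t ht
    have hcs := real_inner_le_norm (gradient f (AffineMap.lineMap x y t) - gradient f x) (y - x)
    have hstep : ‖(AffineMap.lineMap x y t : E) - x‖ = t * ‖y - x‖ := by
      rw [AffineMap.lineMap_apply, vsub_eq_sub, vadd_eq_add, add_sub_cancel_right, norm_smul,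
        Real.norm_of_nonneg ht.1]
    have hmul := mul_le_mul_of_nonneg_right (hlip (AffineMap.lineMap x y t) x)
      (norm_nonneg (y - x))
    rw [hstep] at hmul
    rw [inner_sub_left] at hcs
    linarith

/-- The interpolation inequality for smooth strongly convex functions. -/
lemma StrongConvexOn.interpolation_le
    {E : Type*} [NormedAddCommGroup E] [InnerProductSpace ℝ E] [CompleteSpace E]
    {f : E → ℝ} {s L : ℝ} (hsc : StrongConvexOn Set.univ s f) (hs : 0 ≤ s) (hL : 0 < L)
    (hf : Differentiable ℝ f)
    (hlip : ∀ x y, ‖gradient f x - gradient f y‖ ≤ L * ‖x - y‖) (x y : E) :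
    1 / 2 * ‖gradient f y - gradient f x‖ ^ 2 - s * ⟪gradient f y - gradient f x, y - x⟫
        + s * L / 2 * ‖y - x‖ ^ 2
      ≤ L * (f y - f x - ⟪gradient f x, y - x⟫) := by
  set h := gradient f y - gradient f x with hh
  set r := h - s • (y - x) with hr
  have hlow := hsc.add_inner_gradient_add_sq_le hf x (y - L⁻¹ • r)
  have hup := le_add_inner_gradient_add_sq_of_lipschitz hf hlip y (y - L⁻¹ • r)
  have hgy : gradient f y = gradient f x + h := by rw [hh]; abel
  have hxr : y - L⁻¹ • r - x = (y - x) - L⁻¹ • r := by abel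
  have hyr : y - L⁻¹ • r - y = -(L⁻¹ • r) := by abel
  rw [hxr, norm_sub_sq_real, inner_sub_right, inner_smul_right, inner_smul_right, norm_smul,
    Real.norm_of_nonneg (inv_nonneg.mpr hL.le)] at hlow
  rw [hyr, hgy, inner_neg_right, norm_neg, inner_add_left, inner_smul_right, inner_smul_right,
    norm_smul, Real.norm_of_nonneg (inv_nonneg.mpr hL.le)] at hup
  have hrr : ⟪h, r⟫ - s * ⟪y - x, r⟫ = ‖r‖ ^ 2 := by
    rw [← real_inner_self_eq_norm_sq r, ← real_inner_smul_left, ← inner_sub_left]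
  have hrsq : ‖r‖ ^ 2 = ‖h‖ ^ 2 - 2 * (s * ⟪h, y - x⟫) + s ^ 2 * ‖y - x‖ ^ 2 := by
    rw [hr, norm_sub_sq_real, inner_smul_right, norm_smul, mul_pow, Real.norm_of_nonneg hs]
  have hmain : L * (f x + ⟪gradient f x, y - x⟫ + s / 2 * ‖y - x‖ ^ 2 - f y)
      + 1 / 2 * ‖r‖ ^ 2 + s / (2 * L) * ‖r‖ ^ 2 ≤ 0 := by
    have hmul := mul_le_mul_of_nonneg_left (hlow.trans hup) hL.le
    have e : L * (f x + ⟪gradient f x, y - x⟫ + s / 2 * ‖y - x‖ ^ 2 - f y)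
        + 1 / 2 * ‖r‖ ^ 2 + s / (2 * L) * ‖r‖ ^ 2
        = L * (f x + (⟪gradient f x, y - x⟫ - L⁻¹ * ⟪gradient f x, r⟫)
            + s / 2 * (‖y - x‖ ^ 2 - 2 * (L⁻¹ * ⟪y - x, r⟫) + (L⁻¹ * ‖r‖) ^ 2))
          - L * (f y + -(L⁻¹ * ⟪gradient f x, r⟫ + L⁻¹ * ⟪h, r⟫)
            + L / 2 * (L⁻¹ * ‖r‖) ^ 2) := by
      have hhr : ⟪h, r⟫ = ‖r‖ ^ 2 + s * ⟪y - x, r⟫ := by linarith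
      rw [hhr]
      field_simp
      ring
    linarith
  have h1 : 0 ≤ s / (2 * L) * ‖r‖ ^ 2 := by positivity
  have h2 : 0 ≤ s ^ 2 * ‖y - x‖ ^ 2 := by positivity
  linarith

/-- Updating one entry of a table changes a sum over the table by a single difference. -/
lemma sum_apply_update {ι A M : Type*} [Fintype ι] [DecidableEq ι] [AddCommGroup M]
    (F : ι → A → M) (φ : ι → A) (j : ι) (x : A) :
    ∑ i, F i (Function.update φ j x i) = ∑ i, F i (φ i) + (F j x - F j (φ j)) := by
  rw [← sub_eq_iff_eq_add', ← Finset.sum_sub_distrib, Finset.sum_eq_single j]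
  · simp
  · intro i _ hij
    simp [hij]
  · simp

/-- The terms of the Finito Lyapunov function other than the function values depend on the table
only through averages. -/
lemma finito_quadratic_terms_eq
    {E : Type*} [NormedAddCommGroup E] [InnerProductSpace ℝ E]
    {n : ℕ} (hn : (n : ℝ) ≠ 0) {s α : ℝ} (hs : s ≠ 0) (hα : α ≠ 0) (ψ g : Fin n → E)
    {m G w : E} (hm : ∑ i, ψ i = (n : ℝ) • m) (hG : ∑ i, g i = (n : ℝ) • G)
    (hw : w = m - (1 / (α * s)) • G) :
    -(1 / (n : ℝ)) * ∑ i, ⟪g i, w - ψ i⟫ - s / (2 * (n : ℝ)) * ∑ i, ‖w - ψ i‖ ^ 2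
        + s / (2 * (n : ℝ)) * ∑ i, ‖m - ψ i‖ ^ 2
      = 1 / (n : ℝ) * ∑ i, ⟪g i, ψ i⟫ - ⟪G, m⟫ + (1 / α - 1 / (2 * α ^ 2)) / s * ‖G‖ ^ 2 := by
  have hsq (x : E) : ∑ i, ‖x - ψ i‖ ^ 2
      = n * ‖x‖ ^ 2 - 2 * (n * ⟪x, m⟫) + ∑ i, ‖ψ i‖ ^ 2 := by
    simp_rw [norm_sub_sq_real, sum_add_distrib, sum_sub_distrib, ← mul_sum, ← inner_sum, hm,
      inner_smul_right]
    simp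
  have hin : ∑ i, ⟪g i, w - ψ i⟫ = n * ⟪G, w⟫ - ∑ i, ⟪g i, ψ i⟫ := by
    simp_rw [inner_sub_right, sum_sub_distrib, ← sum_inner, hG, real_inner_smul_left]
  rw [hsq, hsq, hin, hw, norm_sub_sq_real, inner_sub_left, inner_sub_right,
    real_inner_smul_left, inner_smul_right, inner_smul_right, norm_smul, mul_pow,
    Real.norm_eq_abs, sq_abs, real_inner_self_eq_norm_sq, real_inner_self_eq_norm_sq,
    real_inner_comm m G]
  field_simp
  ring

/-- (One-step Lyapunov decrease) Under the Finito setup with Lyapunov function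
`T = T1 + T2 + T3 + T4`, if `α ≥ 2`, `β ≥ 2`, `2/α - 1/α² - β + β/α ≤ 0`, and the
big data condition `n ≥ βL/s` holds, then the uniform average over the choice of
updated index `j` satisfies `(1/n) ∑ j, T(φ⁽ʲ⁾) - T(φ) ≤ -(1/(αn)) T(φ)`. -/
theorem finito_lyapunov_decrease
    {E : Type*} [NormedAddCommGroup E] [InnerProductSpace ℝ E] [FiniteDimensional ℝ E]
    (n : ℕ) (hn : 1 ≤ n) (f : Fin n → E → ℝ)
    (hdiff : ∀ i, Differentiable ℝ (f i))
    (s : ℝ) (hs : 0 < s)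
    (hsc : ∀ i, StrongConvexOn Set.univ s (f i))
    (L : ℝ) (hL : 0 < L)
    (hlip : ∀ i, ∀ x y : E, ‖gradient (f i) x - gradient (f i) y‖ ≤ L * ‖x - y‖)
    (F : E → ℝ) (hF : F = fun x => (1/(n:ℝ)) * ∑ i, f i x)
    (α β : ℝ) (hα : 2 ≤ α) (hβ : 2 ≤ β)
    (hcond : 2/α - 1/α^2 - β + β/α ≤ 0)
    (hbig : (n:ℝ) ≥ β * L / s)
    (φ : Fin n → E)
    -- the Finito point of an arbitrary table ψ
    (w : (Fin n → E) → E)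
    (hw : ∀ ψ : Fin n → E,
      w ψ = ((1/(n:ℝ)) • ∑ i, ψ i)
            - ((1/(α * s * (n:ℝ))) • ∑ i, gradient (f i) (ψ i)))
    -- the Lyapunov function T = T1 + T2 + T3 + T4 of an arbitrary table ψ
    (T : (Fin n → E) → ℝ)
    (hT : ∀ ψ : Fin n → E, T ψ
      = F ((1/(n:ℝ)) • ∑ i, ψ i)
        + ((-(1/(n:ℝ)) * ∑ i, f i (ψ i))
            - (1/(n:ℝ)) * ∑ i, ⟪gradient (f i) (ψ i), w ψ - ψ i⟫)
        + (-(s/(2 * (n:ℝ))) * ∑ i, ‖w ψ - ψ i‖^2)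
        + (s/(2 * (n:ℝ))) * ∑ i, ‖((1/(n:ℝ)) • ∑ l, ψ l) - ψ i‖^2) :
    ((1/(n:ℝ)) * ∑ j, T (Function.update φ j (w φ))) - T φ
      ≤ -(1/(α * (n:ℝ))) * T φ := by
  have hN : (0 : ℝ) < n := by exact_mod_cast hn
  have hα0 : 0 < α := by linarith
  set c : ℝ := 1 / α - 1 / (2 * α ^ 2) with hc
  have hF' (x : E) : F x = 1 / n * ∑ i, f i x := by rw [hF]
  have hsum (v : Fin n → E) : ∑ i, v i = (n : ℝ) • ((1 / (n : ℝ)) • ∑ i, v i) := by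
    rw [smul_smul, mul_one_div_cancel hN.ne', one_smul]
  have hw' (ψ : Fin n → E) : w ψ = (1 / (n : ℝ)) • ∑ i, ψ i
      - (1 / (α * s)) • ((1 / (n : ℝ)) • ∑ i, gradient (f i) (ψ i)) := by
    rw [hw, smul_smul]
    congr 2
    field_simp
  have hT' (ψ : Fin n → E) : T ψ = F ((1 / (n : ℝ)) • ∑ i, ψ i)
      - 1 / n * ∑ i, (f i (ψ i) - ⟪gradient (f i) (ψ i), ψ i⟫)
      - ⟪(1 / (n : ℝ)) • ∑ i, gradient (f i) (ψ i), (1 / (n : ℝ)) • ∑ i, ψ i⟫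
      + c / s * ‖(1 / (n : ℝ)) • ∑ i, gradient (f i) (ψ i)‖ ^ 2 := by
    have h := finito_quadratic_terms_eq hN.ne' hs.ne' hα0.ne' ψ
      (fun i => gradient (f i) (ψ i)) (hsum _) (hsum _) (hw' ψ)
    rw [hT, sum_sub_distrib]
    linarith
  -- averages of the component inequalities
  set D : E → E := fun x => (1 / (n : ℝ)) • ∑ i, gradient (f i) x with hD
  have hDinner (x v : E) : 1 / (n : ℝ) * ∑ i, ⟪gradient (f i) x, v⟫ = ⟪D x, v⟫ := by
    rw [hD, real_inner_smul_left, sum_inner]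
  have hconst (x : ℝ) : 1 / (n : ℝ) * ∑ _i : Fin n, x = x := by
    rw [sum_const, card_univ, Fintype.card_fin, nsmul_eq_mul, ← mul_assoc,
      one_div_mul_cancel hN.ne', one_mul]
  have hFlow (x y : E) : F x + ⟪D x, y - x⟫ + s / 2 * ‖y - x‖ ^ 2 ≤ F y := by
    have h := mul_le_mul_of_nonneg_left (sum_le_sum fun i (_ : i ∈ univ) =>
      (hsc i).add_inner_gradient_add_sq_le (hdiff i) x y) (one_div_nonneg.mpr hN.le)
    rwa [sum_add_distrib, sum_add_distrib, mul_add, mul_add, hDinner, hconst, ← hF', ← hF'] at h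
  have hFup (x y : E) : F y ≤ F x + ⟪D x, y - x⟫ + L / 2 * ‖y - x‖ ^ 2 := by
    have h := mul_le_mul_of_nonneg_left (sum_le_sum fun i (_ : i ∈ univ) =>
      le_add_inner_gradient_add_sq_of_lipschitz (hdiff i) (hlip i) x y)
      (one_div_nonneg.mpr hN.le)
    rwa [sum_add_distrib, sum_add_distrib, mul_add, mul_add, hDinner, hconst, ← hF', ← hF'] at h
  set m : E := (1 / (n : ℝ)) • ∑ i, φ i with hm
  set g : Fin n → E := fun i => gradient (f i) (φ i) with hg
  set G : E := (1 / (n : ℝ)) • ∑ i, g i with hG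
  set p : E := w φ with hp
  set d : Fin n → E := fun j => p - φ j with hd
  set h : Fin n → E := fun j => gradient (f j) p - g j with hh
  set B : Fin n → ℝ := fun j => f j p - f j (φ j) - ⟪g j, d j⟫ with hB
  have hupdate (j : Fin n) : T (Function.update φ j p) = F (m + (1 / (n : ℝ)) • d j)
      - 1 / n * (∑ i, (f i (φ i) - ⟪g i, φ i⟫) + (B j - ⟪h j, p⟫))
      - ⟪G + (1 / (n : ℝ)) • h j, m + (1 / (n : ℝ)) • d j⟫
      + c / s * ‖G + (1 / (n : ℝ)) • h j‖ ^ 2 := by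
    rw [hT', sum_apply_update (fun _ x => x) φ j p,
      sum_apply_update (fun i x => gradient (f i) x) φ j p,
      sum_apply_update (fun i x => f i x - ⟪gradient (f i) x, x⟫) φ j p, smul_add, smul_add]
    have : B j - ⟪h j, p⟫
        = f j p - ⟪gradient (f j) p, p⟫ - (f j (φ j) - ⟪gradient (f j) (φ j), φ j⟫) := by
      simp only [hB, hh, hd, hg, inner_sub_left, inner_sub_right]
      ring
    rw [this]
  have hTφ : T φ = F m - 1 / n * ∑ i, (f i (φ i) - ⟪g i, φ i⟫) - ⟪G, m⟫ + c / s * ‖G‖ ^ 2 :=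
    hT' φ
  have hinterp (j : Fin n) :
      1 / n * (L / 2 * ‖d j‖ ^ 2 - ⟪h j, d j⟫ + c / s * ‖h j‖ ^ 2) ≤ (1 - 1 / α) * B j := by
    have hkey : 1 / 2 * ‖h j‖ ^ 2 - s * ⟪h j, d j⟫ + s * L / 2 * ‖d j‖ ^ 2 ≤ L * B j :=
      (hsc j).interpolation_le hs.le hL (hdiff j) (hlip j) (φ j) p
    have hBnonneg : 0 ≤ B j := by
      have h1 : f j (φ j) + ⟪g j, d j⟫ + s / 2 * ‖d j‖ ^ 2 ≤ f j p :=
        (hsc j).add_inner_gradient_add_sq_le (hdiff j) (φ j) p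
      have h2 : 0 ≤ s / 2 * ‖d j‖ ^ 2 := by positivity
      simp only [hB]
      linarith
    have hc2 : c * ‖h j‖ ^ 2 ≤ 1 / 2 * ‖h j‖ ^ 2 := by
      refine mul_le_mul_of_nonneg_right ?_ (sq_nonneg _)
      have h1 : 1 / 2 - c = 1 / 2 * (1 / α - 1) ^ 2 := by
        rw [hc]
        field_simp
        ring
      have h2 := sq_nonneg (1 / α - 1)
      linarith
    have hns : 2 * L ≤ n * s := by
      have h1 := (div_le_iff₀ hs).mp hbig
      have h2 := mul_le_mul_of_nonneg_right hβ hL.le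
      linarith
    have hγ : 1 / α ≤ 1 / 2 := one_div_le_one_div_of_le two_pos hα
    calc 1 / n * (L / 2 * ‖d j‖ ^ 2 - ⟪h j, d j⟫ + c / s * ‖h j‖ ^ 2)
        = (c * ‖h j‖ ^ 2 - s * ⟪h j, d j⟫ + s * L / 2 * ‖d j‖ ^ 2) / (n * s) := by
          field_simp
          ring
      _ ≤ 1 / 2 * B j := by
          rw [div_le_iff₀ (by positivity)]
          have := mul_le_mul_of_nonneg_right hns hBnonneg
          linarith
      _ ≤ (1 - 1 / α) * B j := mul_le_mul_of_nonneg_right (by linarith) hBnonneg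
  clear_value B h d G g m p D c
  have hstep (j : Fin n) : n * (T (Function.update φ j p) - T φ)
      ≤ ⟪D m - G, d j⟫ + ⟪p - m + (2 * c / s) • G, h j⟫ - 1 / α * B j := by
    have h1 := hFup m (m + (1 / (n : ℝ)) • d j)
    rw [add_sub_cancel_left, inner_smul_right, norm_smul, mul_pow, Real.norm_eq_abs, sq_abs] at h1
    have h2 := mul_le_mul_of_nonneg_left h1 hN.le
    have h3 := hinterp j
    rw [hupdate, hTφ, norm_add_sq_real, norm_smul, mul_pow, Real.norm_eq_abs, sq_abs,
      inner_add_left, inner_add_right, inner_add_right, inner_sub_left, inner_add_left,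
      inner_sub_left]
    simp only [inner_smul_right, real_inner_smul_left]
    rw [real_inner_comm (h j) p, real_inner_comm (h j) m]
    have e : n * (F (m + (1 / (n : ℝ)) • d j)
          - 1 / n * (∑ i, (f i (φ i) - ⟪g i, φ i⟫) + (B j - ⟪h j, p⟫))
          - (⟪G, m⟫ + 1 / n * ⟪G, d j⟫ + (1 / n * ⟪h j, m⟫ + 1 / n * (1 / n * ⟪h j, d j⟫)))
          + c / s * (‖G‖ ^ 2 + 2 * (1 / n * ⟪G, h j⟫) + (1 / n) ^ 2 * ‖h j‖ ^ 2)
          - (F m - 1 / n * ∑ i, (f i (φ i) - ⟪g i, φ i⟫) - ⟪G, m⟫ + c / s * ‖G‖ ^ 2))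
        = n * F (m + (1 / (n : ℝ)) • d j)
          - n * (F m + 1 / n * ⟪D m, d j⟫ + L / 2 * ((1 / n) ^ 2 * ‖d j‖ ^ 2))
          + (⟪D m, d j⟫ - ⟪G, d j⟫ + (⟪h j, p⟫ - ⟪h j, m⟫ + 2 * c / s * ⟪G, h j⟫) - B j)
          + 1 / n * (L / 2 * ‖d j‖ ^ 2 - ⟪h j, d j⟫ + c / s * ‖h j‖ ^ 2) := by
      field_simp
      ring
    linarith
  -- averaging over the updated index
  set e : E := p - m with he
  clear_value e
  have hGe : G = -(α * s) • e := by
    have h1 : e = -((1 / (α * s)) • G) := by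
      rw [he, hp, hw' φ, hm, hG, hg]
      abel
    rw [h1, smul_neg, neg_smul, neg_neg, smul_smul, mul_one_div_cancel (by positivity), one_smul]
  have hdavg : (1 / (n : ℝ)) • ∑ j, d j = e := by
    simp only [hd, sum_sub_distrib, smul_sub, sum_const, card_univ, Fintype.card_fin]
    rw [← Nat.cast_smul_eq_nsmul ℝ, smul_smul, one_div_mul_cancel hN.ne', one_smul, he, hm]
  have hhavg : (1 / (n : ℝ)) • ∑ j, h j = D p - G := by
    simp only [hh, sum_sub_distrib, smul_sub, hD, hG]
  have havg (v : E) (u : Fin n → E) :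
      1 / (n : ℝ) * ∑ j, ⟪v, u j⟫ = ⟪v, (1 / (n : ℝ)) • ∑ j, u j⟫ := by
    rw [inner_smul_right, inner_sum]
  have hmean := mul_le_mul_of_nonneg_left (sum_le_sum fun j (_ : j ∈ univ) => hstep j)
    (one_div_nonneg.mpr hN.le)
  rw [sum_sub_distrib, sum_add_distrib, mul_sub, mul_add, havg, havg, hdavg, hhavg, ← mul_sum,
    ← mul_sum, sum_sub_distrib, mul_left_comm, mul_sub, hconst] at hmean
  have hBavg : 1 / (n : ℝ) * ∑ j, B j
      = F p - 1 / n * ∑ i, (f i (φ i) - ⟪g i, φ i⟫) - ⟪G, p⟫ := by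
    have h1 : ∑ j, B j = ∑ j, f j p - ∑ i, (f i (φ i) - ⟪g i, φ i⟫) - ∑ j, ⟪g j, p⟫ := by
      rw [← sum_sub_distrib, ← sum_sub_distrib]
      refine sum_congr rfl fun j _ => ?_
      simp only [hB, hd, inner_sub_right]
      ring
    rw [h1, mul_sub, mul_sub, ← hF', hG, real_inner_smul_left, sum_inner]
  have hTB : T φ = F m - F p + 1 / n * ∑ j, B j - s / 2 * ‖e‖ ^ 2 := by
    have h1 : ⟪G, p⟫ - ⟪G, m⟫ = -(α * s) * ‖e‖ ^ 2 := by
      rw [← inner_sub_right, ← he, hGe, real_inner_smul_left, real_inner_self_eq_norm_sq]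
    have h2 : c / s * ‖G‖ ^ 2 = (α - 1 / 2) * s * ‖e‖ ^ 2 := by
      rw [hGe, norm_smul, mul_pow, Real.norm_eq_abs, sq_abs, hc]
      field_simp
    rw [hBavg, hTφ, h2]
    linarith
  have hcoef : e + (2 * c / s) • G = -(1 - 1 / α) • e := by
    rw [hGe, smul_smul]
    nth_rw 1 [← one_smul ℝ e]
    rw [← add_smul, hc]
    congr 1
    field_simp
    ring
  rw [hcoef, real_inner_smul_left, inner_sub_left, inner_sub_right, hGe, real_inner_smul_left,
    inner_smul_right, real_inner_self_eq_norm_sq, real_inner_comm (D p) e] at hmean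
  have hmp := hFlow m p
  have hpm := hFlow p m
  rw [← he] at hmp
  rw [← neg_sub p m, ← he, inner_neg_right, norm_neg] at hpm
  have hγ : 0 ≤ 1 - 1 / α := by
    rw [sub_nonneg, div_le_one hα0]
    linarith
  have hpm' := mul_le_mul_of_nonneg_left hpm hγ
  have hscaled : n * (1 / n * ∑ j, T (Function.update φ j p) - T φ) ≤ -(1 / α * T φ) := by
    have hαα : 1 / α * α = 1 := one_div_mul_cancel hα0.ne'
    rw [hTB] at hmean ⊢
    linear_combination hmean + hmp + hpm' + (s * ‖e‖ ^ 2) * hαα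
  rw [show -(1 / (α * (n : ℝ))) * T φ = -(1 / α * T φ) / n by field_simp,
    le_div_iff₀ hN, mul_comm]
  exact hscaled
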